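/- arXiv:1505.06433 — 11 statements merged into one kernel-verified Lean document; each statement's English description precedes it below -/
import Mathlib

section
/- Let D be an integral domain with fraction field F, and let ⋆ be a self-map of Submodule D F with ⋆(⊥) = ⊥. Then the following are equivalent: (1) ⋆ is a closure operation on Submodule D F and ⋆(a • I) = a • ⋆I for every a : F and every I (i.e., ⋆ is a semistar operation on D); (2) ⋆ is a closure operation and ⋆I * ⋆J ≤ ⋆(I * J) for all I, J (i.e., ⋆ is a nucleus for submodule multiplication); (3) ⋆ is a closure operation and ⋆(⋆I * ⋆J) = ⋆(I * J) for all I, J; (4) for all submodules H, I, J of F: H * J ≤ ⋆I if and only if H * ⋆J ≤ ⋆I. -/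
open Pointwise

/-- A closure operation on a poset: expansive, monotone, idempotent. -/
def IsClosureOp {S : Type*} [Preorder S] (star : S → S) : Prop :=
  (∀ x, x ≤ star x) ∧ (∀ x y, x ≤ y → star x ≤ star y) ∧ (∀ x, star (star x) = star x)

/-- In an ordered commutative monoid, `star` is a nucleus exactly when `H * J` and `H * star J`
lie below the same elements of the form `star I`. -/
theorem isClosureOp_and_mul_le_iff {S : Type*} [PartialOrder S] [CommMonoid S] [MulLeftMono S]
    (star : S → S) :
    (IsClosureOp star ∧ ∀ I J, star I * star J ≤ star (I * J)) ↔
      ∀ H I J, H * J ≤ star I ↔ H * star J ≤ star I := by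
  constructor
  · rintro ⟨⟨hexp, hmono, hidem⟩, hmul⟩ H I J
    refine ⟨fun h ↦ ?_, (mul_le_mul_right (hexp J) H).trans⟩
    calc H * star J ≤ star H * star J := mul_le_mul_left (hexp H) _
      _ ≤ star (H * J) := hmul H J
      _ ≤ star (star I) := hmono _ _ h
      _ = star I := hidem I
  · intro h
    have key : ∀ I J, J ≤ star I ↔ star J ≤ star I := fun I J ↦ by simpa using h 1 I J
    have hexp : ∀ I, I ≤ star I := fun I ↦ (key I I).2 le_rfl
    refine ⟨⟨hexp, fun I J hIJ ↦ (key J I).1 (hIJ.trans (hexp J)),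
      fun I ↦ ((key I (star I)).1 le_rfl).antisymm (hexp _)⟩, fun I J ↦ ?_⟩
    have hIJ : I * star J ≤ star (I * J) := (h I (I * J) J).1 (hexp _)
    rw [mul_comm] at hIJ ⊢
    exact (h (star J) (I * J) I).1 hIJ

theorem IsClosureOp.mul_le_iff_star_mul_eq {S : Type*} [PartialOrder S] [CommMonoid S]
    [MulLeftMono S] {star : S → S} (hstar : IsClosureOp star) :
    (∀ I J, star I * star J ≤ star (I * J)) ↔ ∀ I J, star (star I * star J) = star (I * J) := by
  obtain ⟨hexp, hmono, hidem⟩ := hstar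
  refine ⟨fun h I J ↦ le_antisymm ?_ (hmono _ _ (mul_le_mul' (hexp I) (hexp J))),
    fun h I J ↦ h I J ▸ hexp _⟩
  exact (hmono _ _ (h I J)).trans_eq (hidem _)

theorem IsClosureOp.smul_eq_iff_mul_le {D F : Type*} [CommRing D] [Field F] [Algebra D F]
    {star : Submodule D F → Submodule D F} (hstar : IsClosureOp star) (hbot : star ⊥ = ⊥) :
    (∀ (a : F) (I : Submodule D F), star (a • I) = a • star I) ↔
      ∀ I J : Submodule D F, star I * star J ≤ star (I * J) := by
  obtain ⟨hexp, hmono, hidem⟩ := hstar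
  constructor
  · intro h
    have key : ∀ I J : Submodule D F, I * star J ≤ star (I * J) := fun I J ↦ by
      refine Submodule.mul_le.2 fun i hi j hj ↦ ?_
      have hle : i • J ≤ I * J := by
        rintro _ ⟨x, hx, rfl⟩
        exact Submodule.mul_mem_mul hi hx
      exact hmono _ _ hle (h i J ▸ Submodule.smul_mem_pointwise_smul j i _ hj)
    intro I J
    calc star I * star J ≤ star (star I * J) := key _ _
      _ ≤ star (star (I * J)) := hmono _ _ (by simpa only [mul_comm] using key J I)
      _ = star (I * J) := hidem _
  · intro h
    have key : ∀ (a : F) (I : Submodule D F), a • star I ≤ star (a • I) := by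
      rintro a I _ ⟨x, hx, rfl⟩
      have hspan : Submodule.span D {a} * I = a • I := by
        ext y
        simp [Submodule.mem_span_singleton_mul, Submodule.mem_smul_pointwise_iff_exists]
      exact hspan ▸ h _ _ (Submodule.mul_mem_mul
        (hexp _ (Submodule.mem_span_singleton_self a)) hx)
    intro a I
    obtain rfl | ha := eq_or_ne a 0
    · simp only [zero_smul, Submodule.zero_eq_bot, hbot]
    · refine le_antisymm (fun x hx ↦ ?_) (key a I)
      have hx' := key a⁻¹ (a • I) (Submodule.smul_mem_pointwise_smul x a⁻¹ _ hx)
      rw [smul_smul, inv_mul_cancel₀ ha, one_smul] at hx'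
      exact ⟨_, hx', smul_inv_smul₀ ha x⟩

theorem stmt0 (D F : Type*) [CommRing D] [IsDomain D] [Field F] [Algebra D F]
    [IsFractionRing D F] (star : Submodule D F → Submodule D F)
    (hbot : star ⊥ = ⊥) :
    List.TFAE
      [ IsClosureOp star ∧ ∀ (a : F) (I : Submodule D F), star (a • I) = a • star I,
        IsClosureOp star ∧ ∀ I J : Submodule D F, star I * star J ≤ star (I * J),
        IsClosureOp star ∧ ∀ I J : Submodule D F, star (star I * star J) = star (I * J),
        ∀ H I J : Submodule D F, H * J ≤ star I ↔ H * star J ≤ star I ] := by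
  tfae_have 1 ↔ 2 := and_congr_right fun h ↦ h.smul_eq_iff_mul_le hbot
  tfae_have 2 ↔ 3 := and_congr_right fun h ↦ h.mul_le_iff_star_mul_eq
  tfae_have 2 ↔ 4 := isClosureOp_and_mul_le_iff star
  tfae_finish
end

section
/- Let Q be a precoherent prequantale: a complete lattice with a multiplication satisfying a * sSup S = ⨆_{s ∈ S} (a * s) and (sSup S) * a = ⨆_{s ∈ S} (s * a) for all a and all sets S, such that every element of Q is the supremum of the compact elements below it and the product of two compact elements is compact. Let ⋆ be a nucleus on Q, and define ⋆_f(x) = ⨆ { ⋆y | y compact and y ≤ x }. Then ⋆_f is a nucleus on Q, ⋆_f is finitary, ⋆_f(x) ≤ ⋆(x) for all x, and every finitary nucleus σ on Q with σ(x) ≤ ⋆(x) for all x satisfies σ(x) ≤ ⋆_f(x) for all x; that is, ⋆_f is the largest finitary nucleus smaller than ⋆. -/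
open CompleteLattice

/-- A nucleus on an ordered magma: a closure operation `star` with
`star x * star y ≤ star (x * y)`. -/
def IsNucleusOp {M : Type*} [Preorder M] [Mul M] (star : M → M) : Prop :=
  IsClosureOp star ∧ ∀ x y, star x * star y ≤ star (x * y)

/-- A closure operation is finitary if it commutes with suprema of nonempty
directed sets. -/
def FinitaryOp {S : Type*} [CompleteLattice S] (star : S → S) : Prop :=
  ∀ Δ : Set S, Δ.Nonempty → DirectedOn (· ≤ ·) Δ → star (sSup Δ) = ⨆ d ∈ Δ, star d

theorem nonempty_isCompactElement_le {Q : Type*} [CompleteLattice Q] (x : Q) :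
    {c | IsCompactElement c ∧ c ≤ x}.Nonempty := by
  refine ⟨⊥, ?_, bot_le⟩
  rintro s u ⟨a, ha⟩ - - -
  exact ⟨a, ha, bot_le⟩

theorem isCompactElement_sup {Q : Type*} [CompleteLattice Q] {a b : Q}
    (ha : IsCompactElement a) (hb : IsCompactElement b) : IsCompactElement (a ⊔ b) := by
  intro s u hs hd hu hab
  obtain ⟨c, hc, hac⟩ := ha s u hs hd hu (le_sup_left.trans hab)
  obtain ⟨d, hds, hbd⟩ := hb s u hs hd hu (le_sup_right.trans hab)
  obtain ⟨e, he, hce, hde⟩ := hd c hc d hds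
  exact ⟨e, he, sup_le (hac.trans hce) (hbd.trans hde)⟩

theorem directedOn_isCompactElement_le {Q : Type*} [CompleteLattice Q] (x : Q) :
    DirectedOn (· ≤ ·) {c | IsCompactElement c ∧ c ≤ x} :=
  fun a ha b hb =>
    ⟨a ⊔ b, ⟨isCompactElement_sup ha.1 hb.1, sup_le ha.2 hb.2⟩, le_sup_left, le_sup_right⟩

theorem mul_mono_of_mul_sSup {Q : Type*} [CompleteLattice Q] [Mul Q]
    (hl : ∀ (a : Q) (S : Set Q), a * sSup S = ⨆ s ∈ S, a * s)
    (hr : ∀ (a : Q) (S : Set Q), sSup S * a = ⨆ s ∈ S, s * a)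
    {a b c d : Q} (hab : a ≤ b) (hcd : c ≤ d) : a * c ≤ b * d := by
  have h₁ : a * c ≤ a * d := by
    have h := hl a {c, d}
    rw [sSup_pair, sup_eq_right.2 hcd] at h
    rw [h]
    exact le_iSup₂_of_le c (by simp) le_rfl
  have h₂ : a * d ≤ b * d := by
    have h := hr d {a, b}
    rw [sSup_pair, sup_eq_right.2 hab] at h
    rw [h]
    exact le_iSup₂_of_le a (by simp) le_rfl
  exact h₁.trans h₂

theorem stmt2 (Q : Type*) [CompleteLattice Q] [Mul Q]
    (hl : ∀ (a : Q) (S : Set Q), a * sSup S = ⨆ s ∈ S, a * s)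
    (hr : ∀ (a : Q) (S : Set Q), sSup S * a = ⨆ s ∈ S, s * a)
    (halg : ∀ x : Q, x = sSup {c | IsCompactElement c ∧ c ≤ x})
    (hcomp : ∀ x y : Q, IsCompactElement x → IsCompactElement y →
      IsCompactElement (x * y))
    (star : Q → Q) (hstar : IsNucleusOp star)
    (starf : Q → Q)
    (hdef : ∀ x, starf x = sSup (star '' {y | IsCompactElement y ∧ y ≤ x})) :
    IsNucleusOp starf ∧ FinitaryOp starf ∧ (∀ x, starf x ≤ star x) ∧
      ∀ σ : Q → Q, IsNucleusOp σ → FinitaryOp σ → (∀ x, σ x ≤ star x) →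
        ∀ x, σ x ≤ starf x := by
  obtain ⟨⟨hexp, hmono, hidem⟩, hmul⟩ := hstar
  have star_le : ∀ {c x}, IsCompactElement c → c ≤ x → star c ≤ starf x := by
    intro c x hc hcx
    rw [hdef]
    exact le_sSup ⟨c, ⟨hc, hcx⟩, rfl⟩
  have starf_le : ∀ {x z}, (∀ c, IsCompactElement c → c ≤ x → star c ≤ z) → starf x ≤ z := by
    intro x z h
    rw [hdef]
    refine sSup_le ?_
    rintro _ ⟨c, hc, rfl⟩
    exact h c hc.1 hc.2
  have starf_mono : ∀ x y, x ≤ y → starf x ≤ starf y := fun x y hxy =>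
    starf_le fun c hc hcx => star_le hc (hcx.trans hxy)
  have le_starf : ∀ x, x ≤ starf x := fun x =>
    (halg x).le.trans (sSup_le fun c hc => (hexp c).trans (star_le hc.1 hc.2))
  refine ⟨⟨⟨le_starf, starf_mono, fun x => le_antisymm ?_ (le_starf _)⟩, fun x y => ?_⟩,
    fun Δ hne hdir => le_antisymm ?_ ?_, fun x => ?_, fun σ _ hfin hle x => ?_⟩
  · refine starf_le fun c hc hcx => ?_
    have hdir : DirectedOn (· ≤ ·) (star '' {y | IsCompactElement y ∧ y ≤ x}) := by
      rintro _ ⟨a, ha, rfl⟩ _ ⟨b, hb, rfl⟩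
      obtain ⟨e, he, hae, hbe⟩ := directedOn_isCompactElement_le x a ha b hb
      exact ⟨star e, ⟨e, he, rfl⟩, hmono _ _ hae, hmono _ _ hbe⟩
    obtain ⟨_, ⟨y, hy, rfl⟩, hcy⟩ :=
      hc _ _ ((nonempty_isCompactElement_le x).image star) hdir (_root_.isLUB_sSup _)
        (hcx.trans (hdef x).le)
    exact ((hmono _ _ hcy).trans (hidem y).le).trans (star_le hy.1 hy.2)
  · rw [hdef x, hr]
    refine iSup₂_le ?_
    rintro _ ⟨c, hc, rfl⟩
    rw [hdef y, hl]
    refine iSup₂_le ?_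
    rintro _ ⟨d, hd, rfl⟩
    exact (hmul c d).trans
      (star_le (hcomp c d hc.1 hd.1) (mul_mono_of_mul_sSup hl hr hc.2 hd.2))
  · refine starf_le fun c hc hcΔ => ?_
    obtain ⟨d, hd, hcd⟩ := hc Δ _ hne hdir (_root_.isLUB_sSup Δ) hcΔ
    exact le_iSup₂_of_le d hd (star_le hc hcd)
  · exact iSup₂_le fun d hd => starf_mono _ _ (le_sSup hd)
  · exact starf_le fun c _ hcx => hmono _ _ hcx
  · have h := hfin _ (nonempty_isCompactElement_le x) (directedOn_isCompactElement_le x)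
    rw [← halg x] at h
    rw [h]
    exact iSup₂_le fun c hc => (hle c).trans (star_le hc.1 hc.2)
end

section
/- Let D be an integral domain with fraction field F, and write 𝔽 for the fractional ideals FractionalIdeal (nonZeroDivisors D) F with their multiplication. Let ⋆ : 𝔽 → 𝔽 be a self-map with ⋆(0) = 0 and ⋆(1) = 1. Then the following are equivalent: (1) ⋆ is a closure operation on 𝔽 and ⋆(spanSingleton a * I) = spanSingleton a * ⋆I for every nonzero a : F and every I (i.e., ⋆ is a star operation on D); (2) ⋆ is a closure operation and ⋆I * ⋆J ≤ ⋆(I * J) for all I, J (i.e., ⋆ is a nucleus); (3) ⋆ is a closure operation and ⋆(⋆I * ⋆J) = ⋆(I * J) for all I, J; (4) for all H, I, J in 𝔽: H * J ≤ ⋆I if and only if H * ⋆J ≤ ⋆I. -/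
open FractionalIdeal in
/-- A closure operation commuting with nonzero principal fractional ideals is submultiplicative
in its second argument. -/
theorem IsClosureOp.mul_star_le {D F : Type*} [CommRing D] [Field F] [Algebra D F]
    [IsFractionRing D F]
    {star : FractionalIdeal (nonZeroDivisors D) F → FractionalIdeal (nonZeroDivisors D) F}
    (hc : IsClosureOp star)
    (hs : ∀ a : F, a ≠ 0 → ∀ I, star (spanSingleton (nonZeroDivisors D) a * I) =
      spanSingleton (nonZeroDivisors D) a * star I)
    (I J : FractionalIdeal (nonZeroDivisors D) F) : I * star J ≤ star (I * J) := by
  rw [FractionalIdeal.mul_le]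
  intro a ha b hb
  rcases eq_or_ne a 0 with rfl | ha0
  · rw [zero_mul]
    exact Submodule.zero_mem (star (I * J) : Submodule D F)
  · have hle : spanSingleton (nonZeroDivisors D) a * J ≤ I * J :=
      mul_le_mul_left (spanSingleton_le_iff_mem.mpr ha) J
    have hstar := hc.2.1 _ _ hle
    rw [hs a ha0] at hstar
    exact hstar (mul_mem_mul (mem_spanSingleton_self _ a) hb)

open FractionalIdeal in
/-- A nucleus commutes with multiplication by nonzero principal fractional ideals. -/
theorem IsClosureOp.star_spanSingleton_mul {D F : Type*} [CommRing D] [Field F] [Algebra D F]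
    [IsFractionRing D F]
    {star : FractionalIdeal (nonZeroDivisors D) F → FractionalIdeal (nonZeroDivisors D) F}
    (hc : IsClosureOp star) (hn : ∀ I J, star I * star J ≤ star (I * J))
    {a : F} (ha : a ≠ 0) (I : FractionalIdeal (nonZeroDivisors D) F) :
    star (spanSingleton (nonZeroDivisors D) a * I) =
      spanSingleton (nonZeroDivisors D) a * star I := by
  have hle : ∀ (b : F) (K : FractionalIdeal (nonZeroDivisors D) F),
      spanSingleton (nonZeroDivisors D) b * star K ≤
        star (spanSingleton (nonZeroDivisors D) b * K) := fun b K =>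
    (mul_le_mul_left (hc.1 _) _).trans (hn _ _)
  refine le_antisymm ?_ (hle a I)
  have h := mul_le_mul_right (hle a⁻¹ (spanSingleton (nonZeroDivisors D) a * I))
    (spanSingleton (nonZeroDivisors D) a)
  simpa only [← mul_assoc, spanSingleton_mul_spanSingleton, mul_inv_cancel₀ ha,
    inv_mul_cancel₀ ha, spanSingleton_one, one_mul] using h

theorem stmt3 (D F : Type*) [CommRing D] [IsDomain D] [Field F] [Algebra D F]
    [IsFractionRing D F]
    (star : FractionalIdeal (nonZeroDivisors D) F → FractionalIdeal (nonZeroDivisors D) F)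
    (h0 : star 0 = 0) (h1 : star 1 = 1) :
    List.TFAE
      [ IsClosureOp star ∧ ∀ (a : F), a ≠ 0 → ∀ I,
          star (FractionalIdeal.spanSingleton (nonZeroDivisors D) a * I) =
            FractionalIdeal.spanSingleton (nonZeroDivisors D) a * star I,
        IsClosureOp star ∧ ∀ I J, star I * star J ≤ star (I * J),
        IsClosureOp star ∧ ∀ I J, star (star I * star J) = star (I * J),
        ∀ H I J, H * J ≤ star I ↔ H * star J ≤ star I ] := by
  tfae_have 1 → 2 := by
    rintro ⟨hc, hs⟩
    refine ⟨hc, fun I J => (hc.mul_star_le hs (star I) J).trans ?_⟩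
    have h := hc.2.1 _ _ (hc.mul_star_le hs J I)
    rwa [hc.2.2, mul_comm J, mul_comm J] at h
  tfae_have 2 → 1 := fun ⟨hc, hn⟩ => ⟨hc, fun _ ha I => hc.star_spanSingleton_mul hn ha I⟩
  tfae_have 2 → 3 := by
    rintro ⟨hc, hn⟩
    refine ⟨hc, fun I J => le_antisymm ?_ (hc.2.1 _ _ (mul_le_mul' (hc.1 I) (hc.1 J)))⟩
    exact (hc.2.1 _ _ (hn I J)).trans_eq (hc.2.2 _)
  tfae_have 3 → 2 := fun ⟨hc, hm⟩ => ⟨hc, fun I J => (hc.1 _).trans_eq (hm I J)⟩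
  tfae_have 2 → 4 := by
    rintro ⟨hc, hn⟩ H I J
    refine ⟨fun h => ?_, (mul_le_mul_right (hc.1 J) H).trans⟩
    calc H * star J ≤ star H * star J := mul_le_mul_left (hc.1 H) _
      _ ≤ star (H * J) := hn H J
      _ ≤ star (star I) := hc.2.1 _ _ h
      _ = star I := hc.2.2 I
  tfae_have 4 → 2 := by
    intro h
    have hone : ∀ I J, J ≤ star I ↔ star J ≤ star I := fun I J => by
      simpa only [one_mul] using h 1 I J
    have hle : ∀ I, I ≤ star I := fun I => (hone I I).mpr le_rfl
    refine ⟨⟨hle, fun I J hIJ => (hone J I).mp (hIJ.trans (hle J)), fun I =>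
      le_antisymm ((hone I (star I)).mp le_rfl) (hle _)⟩, fun I J => ?_⟩
    have hIJ := (h I (I * J) J).mp (hle _)
    rw [mul_comm] at hIJ ⊢
    exact (h (star J) (I * J) I).mp hIJ
  tfae_finish
end

section
/- Let M be a monoid equipped with a partial order in which multiplication is monotone in each argument, and let ⋆ be a closure operation on M. Then the following are equivalent: (1) ⋆x * ⋆y ≤ ⋆(x * y) for all x, y (⋆ is a nucleus); (2) x * ⋆y ≤ ⋆(x * y) and ⋆x * y ≤ ⋆(x * y) for all x, y; (3) ⋆(⋆x * ⋆y) = ⋆(x * y) for all x, y; (4) ⋆-multiplication is associative, i.e., ⋆(⋆(x * y) * z) = ⋆(x * ⋆(y * z)) for all x, y, z. -/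
theorem stmt4 (M : Type*) [Monoid M] [PartialOrder M]
    (hmull : ∀ x y z : M, x ≤ y → z * x ≤ z * y)
    (hmulr : ∀ x y z : M, x ≤ y → x * z ≤ y * z)
    (star : M → M) (hstar : IsClosureOp star) :
    List.TFAE
      [ ∀ x y : M, star x * star y ≤ star (x * y),
        ∀ x y : M, x * star y ≤ star (x * y) ∧ star x * y ≤ star (x * y),
        ∀ x y : M, star (star x * star y) = star (x * y),
        ∀ x y z : M, star (star (x * y) * z) = star (x * star (y * z)) ] := by
  obtain ⟨le_star, star_mono, star_idem⟩ := hstar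
  tfae_have 1 → 2 := fun h x y =>
    ⟨(hmulr _ _ _ (le_star x)).trans (h x y), (hmull _ _ _ (le_star y)).trans (h x y)⟩
  tfae_have 2 → 3 := fun h x y => by
    apply le_antisymm
    · calc star (star x * star y) ≤ star (star (star x * y)) := star_mono _ _ (h (star x) y).1
        _ = star (star x * y) := star_idem _
        _ ≤ star (star (x * y)) := star_mono _ _ (h x y).2
        _ = star (x * y) := star_idem _
    · exact star_mono _ _ ((hmulr _ _ _ (le_star x)).trans (hmull _ _ _ (le_star y)))
  tfae_have 3 → 4 := fun h x y z => by
    rw [← h (star (x * y)) z, star_idem, h, ← h x (star (y * z)), star_idem, h, mul_assoc]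
  tfae_have 4 → 1 := fun h x y => by
    have h_left : star (star x * y) = star (x * y) := by
      simpa only [one_mul, star_idem] using h 1 x y
    have h_right : star (star x * y) = star (star x * star y) := by
      simpa only [mul_one, star_idem] using h (star x) y 1
    exact (le_star _).trans_eq (h_right.symm.trans h_left)
  tfae_finish
end

section
/- Let Q be a prequantale (a complete lattice with a multiplication satisfying a * sSup S = ⨆_{s ∈ S} (a * s) and (sSup S) * a = ⨆_{s ∈ S} (s * a)). Let f : Q → Q be a preclosure, i.e., expansive (x ≤ f x) and monotone, and suppose that x * f(y) ≤ f(x * y) and f(x) * y ≤ f(x * y) for all x, y. Define ⋆(x) = ⨅ { y | x ≤ y and f(y) = y }. Then ⋆ is a nucleus on Q, the fixed points of ⋆ are exactly the fixed points of f, f(x) ≤ ⋆(x) for all x, and ⋆ is the smallest closure operation on Q that is pointwise larger than f. -/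
theorem mul_mono_right_of_mul_sSup {Q : Type*} [CompleteLattice Q] [Mul Q]
    (hl : ∀ (a : Q) (S : Set Q), a * sSup S = ⨆ s ∈ S, a * s) (a : Q) :
    Monotone (a * ·) := by
  intro b c hbc
  have h := hl a {b, c}
  rw [sSup_pair, sup_eq_right.2 hbc, iSup_pair] at h
  exact le_sup_left.trans_eq h.symm

theorem mul_mono_left_of_sSup_mul {Q : Type*} [CompleteLattice Q] [Mul Q]
    (hr : ∀ (a : Q) (S : Set Q), sSup S * a = ⨆ s ∈ S, s * a) (a : Q) :
    Monotone (· * a) := by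
  intro b c hbc
  have h := hr a {b, c}
  rw [sSup_pair, sup_eq_right.2 hbc, iSup_pair] at h
  exact le_sup_left.trans_eq h.symm

theorem sInf_fixed_mul_le {Q : Type*} [CompleteLattice Q] [Mul Q]
    (hr : ∀ (a : Q) (S : Set Q), sSup S * a = ⨆ s ∈ S, s * a)
    {f : Q → Q} (hexp : ∀ x, x ≤ f x) (hmono : ∀ x y, x ≤ y → f x ≤ f y)
    (hfr : ∀ x y, f x * y ≤ f (x * y)) {x y z : Q} (hz : f z = z) (h : x * y ≤ z) :
    sInf {w | x ≤ w ∧ f w = w} * y ≤ z := by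
  set s := sSup {t | t * y ≤ z}
  have hsy : s * y ≤ z := (hr y _).trans_le (iSup₂_le fun _ ht => ht)
  have hfs : f s ≤ s := le_sSup ((hfr s y).trans ((hmono _ _ hsy).trans_eq hz))
  have hle : sInf {w | x ≤ w ∧ f w = w} ≤ s := sInf_le ⟨le_sSup h, hfs.antisymm (hexp s)⟩
  exact (mul_mono_left_of_sSup_mul hr y hle).trans hsy

theorem mul_sInf_fixed_le {Q : Type*} [CompleteLattice Q] [Mul Q]
    (hl : ∀ (a : Q) (S : Set Q), a * sSup S = ⨆ s ∈ S, a * s)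
    {f : Q → Q} (hexp : ∀ x, x ≤ f x) (hmono : ∀ x y, x ≤ y → f x ≤ f y)
    (hfl : ∀ x y, x * f y ≤ f (x * y)) {x y z : Q} (hz : f z = z) (h : x * y ≤ z) :
    x * sInf {w | y ≤ w ∧ f w = w} ≤ z := by
  set s := sSup {t | x * t ≤ z}
  have hxs : x * s ≤ z := (hl x _).trans_le (iSup₂_le fun _ ht => ht)
  have hfs : f s ≤ s := le_sSup ((hfl x s).trans ((hmono _ _ hxs).trans_eq hz))
  have hle : sInf {w | y ≤ w ∧ f w = w} ≤ s := sInf_le ⟨le_sSup h, hfs.antisymm (hexp s)⟩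
  exact (mul_mono_right_of_mul_sSup hl x hle).trans hxs

theorem stmt9 (Q : Type*) [CompleteLattice Q] [Mul Q]
    (hl : ∀ (a : Q) (S : Set Q), a * sSup S = ⨆ s ∈ S, a * s)
    (hr : ∀ (a : Q) (S : Set Q), sSup S * a = ⨆ s ∈ S, s * a)
    (f : Q → Q) (hexp : ∀ x, x ≤ f x) (hmono : ∀ x y, x ≤ y → f x ≤ f y)
    (hfl : ∀ x y, x * f y ≤ f (x * y)) (hfr : ∀ x y, f x * y ≤ f (x * y))
    (star : Q → Q) (hdef : ∀ x, star x = sInf {y | x ≤ y ∧ f y = y}) :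
    IsNucleusOp star ∧ (∀ x, star x = x ↔ f x = x) ∧ (∀ x, f x ≤ star x) ∧
      ∀ c : Q → Q, IsClosureOp c → (∀ x, f x ≤ c x) → ∀ x, star x ≤ c x := by
  have hle : ∀ x, x ≤ star x := fun x => hdef x ▸ le_sInf fun _ hy => hy.1
  have hmin : ∀ {x y}, x ≤ y → f y = y → star x ≤ y := fun {x _} h hy => hdef x ▸ sInf_le ⟨h, hy⟩
  have hfix : ∀ x, f (star x) = star x := fun x => by
    refine le_antisymm ?_ (hexp _)
    conv_rhs => rw [hdef]
    exact le_sInf fun y hy => (hmono _ _ (hmin hy.1 hy.2)).trans_eq hy.2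
  have hfstar : ∀ x, f x ≤ star x := fun x => (hmono _ _ (hle x)).trans_eq (hfix x)
  refine ⟨⟨⟨hle, fun x y h => hmin (h.trans (hle y)) (hfix y),
    fun x => (hmin le_rfl (hfix x)).antisymm (hle _)⟩, fun x y => ?_⟩,
    fun x => ⟨fun h => h ▸ hfix x, fun h => (hmin le_rfl h).antisymm (hle x)⟩, hfstar, ?_⟩
  · rw [hdef x, hdef y]
    exact mul_sInf_fixed_le hl hexp hmono hfl (hfix _)
      (sInf_fixed_mul_le hr hexp hmono hfr (hfix _) (hle _))
  · rintro c ⟨hcexp, -, hcidem⟩ hfc x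
    exact hmin (hcexp x) (((hfc _).trans_eq (hcidem x)).antisymm (hexp _))
end

section
/- Let Q be a prequantale, let M be a complete lattice equipped with a multiplication monotone in each argument, and let f : Q → M satisfy f(x * y) = f(x) * f(y) for all x, y and f(sSup S) = ⨆_{s ∈ S} f(s) for every S ⊆ Q. Define ⋆(x) = ⨆ { y | f(y) = f(x) }. Then ⋆ is a nucleus on Q, f(⋆x) = f(x) for all x, and f is injective on the fixed points of ⋆; moreover, ⋆ is the unique nucleus on Q with these two properties (i.e., if σ is a nucleus with f(σx) = f(x) for all x and f injective on the fixed points of σ, then σ = ⋆). -/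
theorem stmt11 (Q M : Type*) [CompleteLattice Q] [Mul Q] [CompleteLattice M] [Mul M]
    (hl : ∀ (a : Q) (S : Set Q), a * sSup S = ⨆ s ∈ S, a * s)
    (hr : ∀ (a : Q) (S : Set Q), sSup S * a = ⨆ s ∈ S, s * a)
    (hmull : ∀ x y z : M, x ≤ y → z * x ≤ z * y)
    (hmulr : ∀ x y z : M, x ≤ y → x * z ≤ y * z)
    (f : Q → M) (hfm : ∀ x y, f (x * y) = f x * f y)
    (hfs : ∀ S : Set Q, f (sSup S) = ⨆ s ∈ S, f s)
    (star : Q → Q) (hdef : ∀ x, star x = sSup {y | f y = f x}) :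
    IsNucleusOp star ∧ (∀ x, f (star x) = f x) ∧
      (∀ x y, star x = x → star y = y → f x = f y → x = y) ∧
      ∀ σ : Q → Q, IsNucleusOp σ → (∀ x, f (σ x) = f x) →
        (∀ x y, σ x = x → σ y = y → f x = f y → x = y) → σ = star := by
  have f_sup : ∀ x y, f (x ⊔ y) = f x ⊔ f y := fun x y => by
    rw [← sSup_pair, hfs, iSup_pair]
  have f_mono : ∀ {x y}, x ≤ y → f x ≤ f y := fun {x y} h => by
    rw [← sup_eq_right.2 h, f_sup]
    exact le_sup_left
  have f_star : ∀ x, f (star x) = f x := fun x => by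
    rw [hdef, hfs]
    exact le_antisymm (iSup₂_le fun _ h => le_of_eq h) (le_iSup₂_of_le x rfl le_rfl)
  have le_star : ∀ {x y}, f y ≤ f x → y ≤ star x := fun {x y} h => by
    rw [hdef]
    exact le_sup_left.trans (le_sSup (show f (y ⊔ x) = f x by rw [f_sup, sup_eq_right.2 h]))
  refine ⟨⟨⟨fun x => le_star le_rfl, fun x y h => le_star ((f_star x).trans_le (f_mono h)),
    fun x => ?_⟩, fun x y => le_star ?_⟩, f_star, fun x y hx hy h => ?_, fun σ hσ hf hinj => ?_⟩
  · rw [hdef (star x), f_star, ← hdef]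
  · rw [hfm, hfm, f_star, f_star]
  · rw [← hx, ← hy, hdef, hdef, h]
  · funext x
    refine hinj _ _ (hσ.1.2.2 x) (le_antisymm (le_star ?_) (hσ.1.1 _)) ?_
    · rw [hf, f_star]
    · rw [hf, f_star]
end

section
/- Let Q be a unital quantale: a monoid whose underlying type carries a complete lattice structure with a * sSup S = ⨆_{s ∈ S} (a * s) and (sSup S) * a = ⨆_{s ∈ S} (s * a). For a fixed a ∈ Q define v(a) by v(a)(x) = sSup { y | ∀ r s : Q, r * x * s ≤ a → r * y * s ≤ a }. Then v(a) is a nucleus on Q with v(a)(a) = a, and v(a) is the largest such nucleus: every nucleus σ on Q with σ(a) = a satisfies σ(x) ≤ v(a)(x) for all x. Moreover v(a)(x) is the largest element y of Q such that r * x * s ≤ a implies r * y * s ≤ a for all r, s. -/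
section Quantale

variable {Q : Type*} [Monoid Q] [CompleteLattice Q] [IsQuantale Q]

theorem mul_sSup_mul_le_iff {r s a : Q} {S : Set Q} :
    r * sSup S * s ≤ a ↔ ∀ y ∈ S, r * y * s ≤ a := by
  simp only [sSup_eq_iSup', Quantale.mul_iSup_distrib, Quantale.iSup_mul_distrib, iSup_le_iff,
    Subtype.forall]

theorem isGreatest_sSup_setOf_mul_mul_le (a x : Q) :
    IsGreatest {y | ∀ r s : Q, r * x * s ≤ a → r * y * s ≤ a}
      (sSup {y | ∀ r s : Q, r * x * s ≤ a → r * y * s ≤ a}) :=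
  ⟨fun r s h => mul_sSup_mul_le_iff.2 fun _ hy => hy r s h, fun _ hy => le_sSup hy⟩

end Quantale

theorem IsNucleusOp.mul_mul_le {Q : Type*} [Monoid Q] [Preorder Q] [MulLeftMono Q]
    [MulRightMono Q] {σ : Q → Q} (hσ : IsNucleusOp σ) {a r x s : Q} (ha : σ a = a)
    (h : r * x * s ≤ a) : r * σ x * s ≤ a := by
  obtain ⟨⟨le_apply, mono, -⟩, mul_le⟩ := hσ
  calc r * σ x * s ≤ σ r * σ x * σ s :=
        mul_le_mul' (mul_le_mul_left (le_apply r) _) (le_apply s)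
    _ ≤ σ (r * x) * σ s := mul_le_mul_left (mul_le r x) _
    _ ≤ σ (r * x * s) := mul_le _ _
    _ ≤ σ a := mono _ _ h
    _ = a := ha

theorem stmt12 (Q : Type*) [Monoid Q] [CompleteLattice Q]
    (hl : ∀ (a : Q) (S : Set Q), a * sSup S = ⨆ s ∈ S, a * s)
    (hr : ∀ (a : Q) (S : Set Q), sSup S * a = ⨆ s ∈ S, s * a)
    (a : Q) (v : Q → Q)
    (hdef : ∀ x, v x = sSup {y | ∀ r s : Q, r * x * s ≤ a → r * y * s ≤ a}) :
    IsNucleusOp v ∧ v a = a ∧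
      (∀ σ : Q → Q, IsNucleusOp σ → σ a = a → ∀ x, σ x ≤ v x) ∧
      ∀ x, IsGreatest {y | ∀ r s : Q, r * x * s ≤ a → r * y * s ≤ a} (v x) := by
  have : IsQuantale Q := ⟨hl, fun S b => hr b S⟩
  have greatest (x) : IsGreatest {y | ∀ r s : Q, r * x * s ≤ a → r * y * s ≤ a} (v x) :=
    hdef x ▸ isGreatest_sSup_setOf_mul_mul_le a x
  have mul_v_mul_le {x r s : Q} (h : r * x * s ≤ a) : r * v x * s ≤ a := (greatest x).1 r s h
  have le_v {x y : Q} (h : ∀ r s : Q, r * x * s ≤ a → r * y * s ≤ a) : y ≤ v x :=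
    (greatest x).2 h
  have self_le_v (x) : x ≤ v x := le_v fun _ _ h => h
  refine ⟨⟨⟨self_le_v, fun x y hxy => le_v fun r s h => mul_v_mul_le ?_, fun x => ?_⟩,
    fun x y => le_v fun r s h => ?_⟩, ?_, ?_, greatest⟩
  · exact (mul_le_mul' (mul_le_mul' le_rfl hxy) le_rfl).trans h
  · exact (le_v fun _ _ h => mul_v_mul_le (mul_v_mul_le h)).antisymm (self_le_v _)
  · have hx : r * v x * (y * s) ≤ a := mul_v_mul_le (by simpa only [mul_assoc] using h)
    have hy : r * v x * v y * s ≤ a := mul_v_mul_le (by simpa only [mul_assoc] using hx)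
    simpa only [mul_assoc] using hy
  · refine le_antisymm ?_ (self_le_v a)
    simpa using mul_v_mul_le (x := a) (r := 1) (s := 1) (by simp)
  · exact fun σ hσ ha x => le_v fun _ _ h => hσ.mul_mul_le ha h
end

section
/- Let Q be a multiplicative lattice: a commutative monoid whose underlying type carries a complete lattice structure with a * sSup S = ⨆_{s ∈ S} (a * s). Define x / y := sSup {z | z * y ≤ x}. Then for every a ∈ Q the map x ↦ a / (a / x) is a nucleus on Q fixing a, and it is the largest nucleus on Q fixing a: every nucleus σ with σ(a) = a satisfies σ(x) ≤ a / (a / x) for all x. -/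
theorem mul_le_mul_of_mul_sSup {Q : Type*} [CommMonoid Q] [CompleteLattice Q]
    (hl : ∀ (a : Q) (S : Set Q), a * sSup S = ⨆ s ∈ S, a * s)
    {b c d e : Q} (hbc : b ≤ c) (hde : d ≤ e) : b * d ≤ c * e := by
  have mono_right (a : Q) {x y : Q} (hxy : x ≤ y) : a * x ≤ a * y := by
    have h := hl a {x, y}
    rw [sSup_pair, sup_of_le_right hxy, iSup_pair] at h
    exact h ▸ le_sup_left
  calc b * d ≤ b * e := mono_right b hde
    _ = e * b := mul_comm b e
    _ ≤ e * c := mono_right e hbc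
    _ = c * e := mul_comm e c

theorem le_sSup_mul_le_iff {Q : Type*} [CommMonoid Q] [CompleteLattice Q]
    (hl : ∀ (a : Q) (S : Set Q), a * sSup S = ⨆ s ∈ S, a * s) {x y z : Q} :
    z ≤ sSup {w | w * y ≤ x} ↔ z * y ≤ x := by
  refine ⟨fun h => (mul_le_mul_of_mul_sSup hl h le_rfl).trans ?_, fun h => le_sSup h⟩
  rw [mul_comm, hl]
  exact iSup₂_le fun w hw => (mul_comm y w).trans_le hw

theorem stmt13 (Q : Type*) [CommMonoid Q] [CompleteLattice Q]
    (hl : ∀ (a : Q) (S : Set Q), a * sSup S = ⨆ s ∈ S, a * s)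
    (a : Q) (div : Q → Q → Q) (hdiv : ∀ x y, div x y = sSup {z | z * y ≤ x}) :
    IsNucleusOp (fun x => div a (div a x)) ∧ div a (div a a) = a ∧
      ∀ σ : Q → Q, IsNucleusOp σ → σ a = a → ∀ x, σ x ≤ div a (div a x) := by
  have adj {x y z : Q} : z ≤ div x y ↔ z * y ≤ x := by
    rw [hdiv]; exact le_sSup_mul_le_iff hl
  have mono {b c d e : Q} : b ≤ c → d ≤ e → b * d ≤ c * e := mul_le_mul_of_mul_sSup hl
  have div_mul_le (x y : Q) : div x y * y ≤ x := adj.1 le_rfl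
  have le_div_div (x : Q) : x ≤ div a (div a x) :=
    adj.2 ((mul_comm _ _).trans_le (div_mul_le a x))
  have anti {x y : Q} (h : x ≤ y) : div a y ≤ div a x :=
    adj.2 ((mono le_rfl h).trans (div_mul_le a y))
  refine ⟨⟨⟨le_div_div, fun x y h => anti (anti h), fun x => ?_⟩, fun x y => ?_⟩, ?_, ?_⟩
  · exact le_antisymm (anti (le_div_div (div a x))) (le_div_div _)
  · have absorb {u v : Q} (h : u * v ≤ a) : div a (div a v) * u ≤ a :=
      (mono le_rfl (adj.2 h)).trans (div_mul_le a _)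
    refine adj.2 ?_
    have hy : div a (div a y) * (div a (x * y) * x) ≤ a :=
      absorb ((mul_assoc _ _ _).trans_le (div_mul_le a (x * y)))
    rw [← mul_assoc] at hy
    rw [mul_assoc]
    exact absorb hy
  · refine le_antisymm ?_ (le_div_div a)
    have h1 : 1 ≤ div a a := adj.2 (one_mul a).le
    calc div a (div a a) = div a (div a a) * 1 := (mul_one _).symm
      _ ≤ div a (div a a) * div a a := mono le_rfl h1
      _ ≤ a := div_mul_le a _
  · rintro σ ⟨⟨hle, hmono, -⟩, hmul⟩ ha x
    refine adj.2 ?_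
    calc σ x * div a x ≤ σ x * σ (div a x) := mono le_rfl (hle _)
      _ ≤ σ (x * div a x) := hmul _ _
      _ ≤ σ a := hmono _ _ ((mul_comm _ _).trans_le (div_mul_le a x))
      _ = a := ha
end

section
/- Let Q be a multiplicative lattice: a commutative monoid whose underlying type carries a complete lattice structure with a * sSup S = ⨆_{s ∈ S} (a * s). Then the only nuclei on Q are the identity map and the constant map with value ⊤ if and only if every element of Q equals ⊥ or ⊤. -/
open Quantale in
/-- In a commutative quantale, the double residuation `x ↦ (x ⇨ₗ a) ⇨ₗ a` is a nucleus. -/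
theorem isNucleusOp_double_residuation {Q : Type*} [CommSemigroup Q] [CompleteLattice Q]
    [IsQuantale Q] (a : Q) : IsNucleusOp fun x => (x ⇨ₗ a) ⇨ₗ a := by
  have res_mul_le (x : Q) : (x ⇨ₗ a) * x ≤ a := leftMulResiduation_le_iff_mul_le.1 le_rfl
  have anti {x y : Q} (h : x ≤ y) : y ⇨ₗ a ≤ x ⇨ₗ a :=
    leftMulResiduation_le_iff_mul_le.2 ((mul_le_mul_right h _).trans (res_mul_le y))
  have le_double (x : Q) : x ≤ (x ⇨ₗ a) ⇨ₗ a :=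
    leftMulResiduation_le_iff_mul_le.2 (by rw [mul_comm]; exact res_mul_le x)
  refine ⟨⟨le_double, fun x y h => anti (anti h), fun x => ?_⟩, fun x y => ?_⟩
  · exact le_antisymm (anti (le_double _)) (le_double _)
  · set p := (x * y) ⇨ₗ a with hp
    have h₁ : p * x ≤ y ⇨ₗ a :=
      leftMulResiduation_le_iff_mul_le.2 (by rw [mul_assoc]; exact res_mul_le _)
    have h₂ : ((y ⇨ₗ a) ⇨ₗ a) * p ≤ x ⇨ₗ a := by
      rw [leftMulResiduation_le_iff_mul_le, mul_assoc]
      exact (mul_le_mul_right h₁ _).trans (res_mul_le _)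
    rw [leftMulResiduation_le_iff_mul_le, mul_assoc]
    exact (mul_le_mul_right h₂ _).trans (res_mul_le _)

open Quantale in
theorem stmt14 (Q : Type*) [CommMonoid Q] [CompleteLattice Q]
    (hl : ∀ (a : Q) (S : Set Q), a * sSup S = ⨆ s ∈ S, a * s) :
    (∀ star : Q → Q, IsNucleusOp star → star = id ∨ star = fun _ => ⊤) ↔
      ∀ x : Q, x = ⊥ ∨ x = ⊤ := by
  constructor
  · intro H x
    have : IsQuantale Q :=
      ⟨hl, fun S y => by simp only [mul_comm _ y, hl]⟩
    have double_eq {a : Q} (ha : a ≠ ⊤) (y : Q) : (y ⇨ₗ a) ⇨ₗ a = y := by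
      rcases H _ (isNucleusOp_double_residuation a) with h | h
      · exact congrFun h y
      · have one_le : (1 : Q) ≤ a ⇨ₗ a :=
          leftMulResiduation_le_iff_mul_le.2 (one_mul a).le
        have top_mul_le : ⊤ * (a ⇨ₗ a) ≤ a :=
          leftMulResiduation_le_iff_mul_le.1 (congrFun h a).ge
        refine absurd (top_le_iff.1 ?_) ha
        calc (⊤ : Q) = ⊤ * 1 := (mul_one _).symm
          _ ≤ ⊤ * (a ⇨ₗ a) := mul_le_mul_right one_le _
          _ ≤ a := top_mul_le
    by_cases hx : x = ⊤
    · exact Or.inr hx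
    left
    have bot_ne_top : (⊥ : Q) ≠ ⊤ := fun h => hx (top_le_iff.1 (h ▸ bot_le))
    have one_eq_top : (1 : Q) = ⊤ := by
      rw [← double_eq bot_ne_top 1, eq_top_iff, leftMulResiduation_le_iff_mul_le]
      have : (1 : Q) ⇨ₗ ⊥ ≤ ⊥ := by
        simpa using leftMulResiduation_le_iff_mul_le.1 (le_refl ((1 : Q) ⇨ₗ ⊥))
      rw [le_bot_iff.1 this, mul_bot]
    rw [← le_bot_iff, ← double_eq hx ⊥, leftMulResiduation_le_iff_mul_le]
    calc x * (⊥ ⇨ₗ x) ≤ x * 1 := mul_le_mul_right (one_eq_top ▸ le_top) _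
      _ = x := mul_one x
  · rintro H star ⟨⟨le_star, -, -⟩, -⟩
    have star_top : star ⊤ = ⊤ := top_le_iff.1 (le_star ⊤)
    rcases H (star ⊥) with h | h
    · left
      funext x
      rcases H x with rfl | rfl
      exacts [h, star_top]
    · right
      funext x
      rcases H x with rfl | rfl
      exacts [h, star_top]
end

section
/- Let G be a commutative group and consider the power set of WithZero G (G with a zero element adjoined) as a complete lattice under inclusion with pointwise set multiplication X * Y = {x*y | x ∈ X, y ∈ Y}. Let r be a self-map of Set (WithZero G) with r(∅) = {0}. Then the following are equivalent: (1) r is a module system on G, i.e., r is a closure operation and r({c} * X) = {c} * r(X) for every c : WithZero G and every X; (2) r is a closure operation and r(X) * r(Y) ⊆ r(X * Y) for all X, Y (i.e., r is a nucleus); (3) r is a closure operation and r(r(X) * r(Y)) = r(X * Y) for all X, Y; (4) for all X, Y, Z : Set (WithZero G), X * Y ⊆ r(Z) if and only if X * r(Y) ⊆ r(Z). -/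
open Pointwise

theorem mul_subset_of_singleton_mul {M : Type*} [CommMonoid M] {r : Set M → Set M}
    (hr : IsClosureOp r) (h : ∀ (c : M) (X : Set M), r ({c} * X) = {c} * r X) (X Y : Set M) :
    r X * r Y ⊆ r (X * Y) := by
  obtain ⟨_, hmono, hidem⟩ := hr
  have half (X Y : Set M) : X * r Y ⊆ r (X * Y) := by
    rintro _ ⟨x, hx, y, hy, rfl⟩
    refine hmono ({x} * Y) _ (Set.mul_subset_mul_right (Set.singleton_subset_iff.2 hx)) ?_
    rw [h]
    exact Set.mul_mem_mul rfl hy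
  calc r X * r Y ⊆ r (r X * Y) := half _ _
    _ = r (Y * r X) := by rw [mul_comm]
    _ ⊆ r (r (Y * X)) := hmono _ _ (half _ _)
    _ = r (X * Y) := by rw [hidem, mul_comm]

theorem singleton_mul_of_mul_subset {M : Type*} [CommGroupWithZero M] {r : Set M → Set M}
    (h0 : r ∅ = {0}) (hr : IsClosureOp r) (h : ∀ X Y : Set M, r X * r Y ⊆ r (X * Y))
    (c : M) (X : Set M) : r ({c} * X) = {c} * r X := by
  obtain ⟨hexp, hmono, hidem⟩ := hr
  have le (c : M) (X : Set M) : {c} * r X ⊆ r ({c} * X) :=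
    (Set.mul_subset_mul_right (hexp {c})).trans (h _ _)
  refine subset_antisymm ?_ (le c X)
  rcases eq_or_ne c 0 with rfl | hc
  · have hz : r {0} = {0} := by rw [← h0, hidem]
    have hX : (0 : M) ∈ r X := hmono ∅ X (Set.empty_subset X) (by simp [h0])
    calc r ({0} * X) ⊆ r {0} := hmono _ _ (by rintro _ ⟨_, rfl, y, _, rfl⟩; simp)
      _ = {0} := hz
      _ ⊆ {0} * r X := Set.singleton_subset_iff.2 ⟨0, rfl, 0, hX, mul_zero 0⟩
  · intro y hy
    refine ⟨c, rfl, c⁻¹ * y, ?_, mul_inv_cancel_left₀ hc y⟩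
    have hy' := le c⁻¹ ({c} * X) (Set.mul_mem_mul rfl hy)
    rwa [← mul_assoc, Set.singleton_mul_singleton, inv_mul_cancel₀ hc, Set.singleton_one,
      one_mul] at hy'

theorem isClosureOp_of_mul_subset_iff {M : Type*} [Monoid M] {r : Set M → Set M}
    (h : ∀ X Y Z : Set M, X * Y ⊆ r Z ↔ X * r Y ⊆ r Z) : IsClosureOp r := by
  have h1 (Y Z : Set M) : Y ⊆ r Z ↔ r Y ⊆ r Z := by simpa using h 1 Y Z
  have hexp (X : Set M) : X ⊆ r X := (h1 X X).2 subset_rfl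
  exact ⟨hexp, fun X Y hXY => (h1 X Y).1 (hXY.trans (hexp Y)),
    fun X => subset_antisymm ((h1 _ _).1 subset_rfl) (hexp _)⟩

theorem stmt18 (G : Type*) [CommGroup G]
    (r : Set (WithZero G) → Set (WithZero G)) (h0 : r ∅ = {0}) :
    List.TFAE
      [ IsClosureOp r ∧ ∀ (c : WithZero G) (X : Set (WithZero G)),
          r ({c} * X) = {c} * r X,
        IsClosureOp r ∧ ∀ X Y : Set (WithZero G), r X * r Y ⊆ r (X * Y),
        IsClosureOp r ∧ ∀ X Y : Set (WithZero G), r (r X * r Y) = r (X * Y),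
        ∀ X Y Z : Set (WithZero G), X * Y ⊆ r Z ↔ X * r Y ⊆ r Z ] := by
  tfae_have 1 → 2 := fun ⟨hr, h⟩ => ⟨hr, mul_subset_of_singleton_mul hr h⟩
  tfae_have 2 → 1 := fun ⟨hr, h⟩ => ⟨hr, singleton_mul_of_mul_subset h0 hr h⟩
  tfae_have 2 → 3 := fun ⟨hr, h⟩ => ⟨hr, fun X Y => subset_antisymm
    ((hr.2.1 _ _ (h X Y)).trans (hr.2.2 _).subset)
    (hr.2.1 _ _ (Set.mul_subset_mul (hr.1 X) (hr.1 Y)))⟩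
  tfae_have 3 → 2 := fun ⟨hr, h⟩ => ⟨hr, fun X Y => (hr.1 (r X * r Y)).trans (h X Y).subset⟩
  tfae_have 2 → 4 := fun ⟨hr, h⟩ X Y Z =>
    ⟨fun hZ => (Set.mul_subset_mul_right (hr.1 X)).trans <| (h X Y).trans <|
      (hr.2.1 _ _ hZ).trans (hr.2.2 Z).subset,
     fun hZ => (Set.mul_subset_mul_left (hr.1 Y)).trans hZ⟩
  tfae_have 4 → 2 := by
    intro h
    have hr := isClosureOp_of_mul_subset_iff h
    refine ⟨hr, fun X Y => ?_⟩
    rw [← h, mul_comm, ← h, mul_comm]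
    exact hr.1 _
  tfae_finish
end

section
/- Let R be a commutative ring of prime characteristic p. For an ideal I of R and e : ℕ, let I^{[p^e]} denote the ideal generated by { x^{p^e} | x ∈ I } (the image of I under the e-th iterate of the Frobenius endomorphism). Let R° denote the set of elements of R lying outside every minimal prime of R. Say x ∈ R lies in I^T if there exist c ∈ R° and N : ℕ such that c * x^{p^e} ∈ I^{[p^e]} for all e ≥ N, and call an ideal J tightly closed if every x with x ∈ J^T lies in J. Define I* = ⨅ { J : Ideal R | I ≤ J and J is tightly closed }. Then the map I ↦ I* is a nucleus on the lattice of ideals of R (it is a closure operation and I* * J* ≤ (I*J)* for all ideals I, J, where * on the right of ≤ denotes ideal multiplication), I* is tightly closed for every ideal I, and I* is the smallest tightly closed ideal containing I. -/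
/-- The `e`-th Frobenius power `I^{[p^e]}` of an ideal `I`: the ideal generated
by the `p^e`-th powers of the elements of `I`. -/
def frobeniusPower {R : Type*} [CommRing R] (p e : ℕ) (I : Ideal R) : Ideal R :=
  Ideal.span ((fun x => x ^ p ^ e) '' (I : Set R))

/-- Membership in the "naive" tight closure `I^T` of an ideal `I` in a ring of
characteristic `p`: there are `c` outside every minimal prime and `N : ℕ`
with `c * x ^ (p ^ e) ∈ I^{[p^e]}` for all `e ≥ N`. -/
def TightMem {R : Type*} [CommRing R] (p : ℕ) (I : Ideal R) (x : R) : Prop :=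
  ∃ c : R, (∀ P ∈ minimalPrimes R, c ∉ P) ∧
    ∃ N : ℕ, ∀ e ≥ N, c * x ^ p ^ e ∈ frobeniusPower p e I

/-- An ideal `J` is tightly closed if `J^T ⊆ J`. -/
def TightlyClosed {R : Type*} [CommRing R] (p : ℕ) (J : Ideal R) : Prop :=
  ∀ x, TightMem p J x → x ∈ J

section TightClosure

variable {R : Type*} [CommRing R] {p : ℕ} {I K : Ideal R} {a x : R}

theorem pow_mul_mem_frobeniusPower (h : ∀ y ∈ I, a * y ∈ K) {e : ℕ}
    (hx : x ∈ frobeniusPower p e I) : a ^ p ^ e * x ∈ frobeniusPower p e K := by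
  induction hx using Submodule.span_induction with
  | mem z hz =>
    obtain ⟨y, hy, rfl⟩ := hz
    exact Ideal.subset_span ⟨a * y, h y hy, mul_pow a y _⟩
  | zero => simp
  | add y z _ _ hy hz => rw [mul_add]; exact add_mem hy hz
  | smul r y _ hy => rw [smul_eq_mul, mul_left_comm]; exact Ideal.mul_mem_left _ r hy

theorem TightMem.mul_left (hx : TightMem p I x) (h : ∀ y ∈ I, a * y ∈ K) :
    TightMem p K (a * x) := by
  obtain ⟨c, hc, N, hN⟩ := hx
  refine ⟨c, hc, N, fun e he => ?_⟩
  rw [mul_pow, mul_left_comm]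
  exact pow_mul_mem_frobeniusPower h (hN e he)

theorem TightMem.mono (hx : TightMem p I x) (h : I ≤ K) : TightMem p K x := by
  simpa using hx.mul_left (a := 1) (K := K) fun y hy => by simpa using h hy

theorem TightlyClosed.sInf {S : Set (Ideal R)} (h : ∀ J ∈ S, TightlyClosed p J) :
    TightlyClosed p (sInf S) := fun x hx =>
  Submodule.mem_sInf.2 fun J hJ => h J hJ x (hx.mono (sInf_le hJ))

theorem TightlyClosed.colon (hK : TightlyClosed p K) (A : Set R) :
    TightlyClosed p (Submodule.colon K A) := fun x hx =>
  Submodule.mem_colon.2 fun a ha => by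
    rw [smul_eq_mul, mul_comm]
    refine hK _ (hx.mul_left fun y hy => ?_)
    rw [mul_comm]
    exact Submodule.mem_colon.1 hy a ha

end TightClosure

theorem stmt19 (R : Type*) [CommRing R] (p : ℕ) (hp : p.Prime) [CharP R p]
    (tc : Ideal R → Ideal R)
    (hdef : ∀ I, tc I = sInf {J : Ideal R | I ≤ J ∧ TightlyClosed p J}) :
    IsClosureOp tc ∧ (∀ I J : Ideal R, tc I * tc J ≤ tc (I * J)) ∧
      (∀ I : Ideal R, TightlyClosed p (tc I)) ∧
      ∀ I J : Ideal R, I ≤ J → TightlyClosed p J → tc I ≤ J := by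
  have le_tc (I) : I ≤ tc I := by
    rw [hdef]
    exact le_sInf fun J hJ => hJ.1
  have closed (I) : TightlyClosed p (tc I) := by
    rw [hdef]
    exact .sInf fun J hJ => hJ.2
  have tc_le (I J : Ideal R) (hIJ : I ≤ J) (hJ : TightlyClosed p J) : tc I ≤ J := by
    rw [hdef]
    exact sInf_le ⟨hIJ, hJ⟩
  refine ⟨⟨le_tc, fun I J h => tc_le _ _ (h.trans (le_tc J)) (closed J),
    fun I => (tc_le _ _ le_rfl (closed I)).antisymm (le_tc _)⟩, fun I J => ?_, closed, tc_le⟩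
  have left : tc I ≤ Submodule.colon (tc (I * J)) (J : Set R) :=
    tc_le _ _ (fun x hx => Submodule.mem_colon.2 fun y hy => le_tc _ (Ideal.mul_mem_mul hx hy))
      ((closed _).colon _)
  have right : tc J ≤ Submodule.colon (tc (I * J)) (tc I : Set R) :=
    tc_le _ _ (fun y hy => Submodule.mem_colon.2 fun x hx => by
      rw [smul_eq_mul, mul_comm y]
      exact Submodule.mem_colon.1 (left hx) y hy) ((closed _).colon _)
  refine Ideal.mul_le.2 fun x hx y hy => ?_
  rw [mul_comm x]
  exact Submodule.mem_colon.1 (right hy) x hx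
end
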